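/- For d = 10, the sign pattern Σ_{2,4,5} is not realizable with the pair (0, 8): there is no monic real polynomial of degree 10 whose coefficients of x^{10}, x^9 are positive, coefficients of x^8, x^7, x^6, x^5 are negative, coefficients of x^4, x^3, x^2, x^1, x^0 are positive, and which has exactly 8 distinct negative roots, all simple, and no other real roots. -/

import Mathlib

open Polynomial

/-- A real polynomial `P` realizes the pair `(pos, neg)` if it has exactly `pos`
distinct positive roots and exactly `neg` distinct negative roots, all of them
simple, and no other real roots. -/
def realizesPair (P : Polynomial ℝ) (pos neg : ℕ) : Prop :=
  P.roots.Nodup ∧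
  (P.roots.filter (fun x => 0 < x)).card = pos ∧
  (P.roots.filter (fun x => x < 0)).card = neg ∧
  (0 : ℝ) ∉ P.roots

namespace Polynomial

theorem Splits.reverse {R : Type*} [Field R] {f : R[X]} (hf : f.Splits) : f.reverse.Splits := by
  refine Submonoid.closure_induction (motive := fun g _ => g.reverse.Splits) ?_ ?_ ?_ hf
  · rintro g (⟨a, rfl⟩ | ⟨a, rfl⟩)
    · simp
    · exact .of_natDegree_le_one ((reverse_natDegree_le _).trans (natDegree_X_add_C a).le)
  · rw [← C_1, reverse_C]; exact Splits.C 1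
  · intro g h _ _ hg hh
    rw [reverse_mul_of_domain]
    exact hg.mul hh

theorem Splits.derivative {f : ℝ[X]} (hf : f.Splits) : (derivative f).Splits := by
  rw [splits_iff_card_roots] at hf ⊢
  have h₁ := card_roots_le_derivative f
  have h₂ := card_roots' (Polynomial.derivative f)
  have h₃ := natDegree_derivative_le f
  omega

theorem Splits.iterate_derivative {f : ℝ[X]} (hf : f.Splits) (n : ℕ) :
    (Polynomial.derivative^[n] f).Splits := by
  induction n with
  | zero => exact hf
  | succ n ih =>
    rw [Function.iterate_succ_apply']
    exact ih.derivative

theorem coeff_pos_of_prod_X_sub_C_neg (s : Multiset ℝ) (hs : ∀ r ∈ s, r < 0) :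
    ∀ k ≤ s.card, 0 < (s.map fun r => X - C r).prod.coeff k := by
  induction s using Multiset.induction with
  | empty => simp
  | cons a s ih =>
    have ha : a < 0 := hs a (Multiset.mem_cons_self a s)
    have ih := ih fun r hr => hs r (Multiset.mem_cons_of_mem hr)
    have hdeg : (s.map fun r => X - C r).prod.natDegree = s.card :=
      natDegree_multiset_prod_X_sub_C_eq_card s
    have hnn : ∀ k, 0 ≤ (s.map fun r => X - C r).prod.coeff k := fun k => by
      rcases le_or_gt k s.card with h | h
      · exact (ih k h).le
      · exact (coeff_eq_zero_of_natDegree_lt (hdeg ▸ h)).ge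
    intro k hk
    rw [Multiset.card_cons] at hk
    rw [Multiset.map_cons, Multiset.prod_cons, sub_mul, coeff_sub, coeff_C_mul]
    rcases k with _ | k
    · rw [coeff_X_mul_zero]
      nlinarith [ih 0 (Nat.zero_le _)]
    · rw [coeff_X_mul]
      nlinarith [ih k (by omega), hnn (k + 1)]

end Polynomial

theorem schur_inequality {x y z : ℝ} (hx : 0 ≤ x) (hy : 0 ≤ y) (hz : 0 ≤ z) :
    0 ≤ x * (x - y) * (x - z) + y * (y - z) * (y - x) + z * (z - x) * (z - y) := by
  wlog hxy : y ≤ x generalizing x y z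
  · linarith [this hy hx hz (le_of_not_ge hxy)]
  wlog hyz : z ≤ y generalizing x y z
  · rcases le_total x z with hxz | hxz
    · linarith [this hz hx hy hxz hxy]
    · linarith [this hx hz hy hxz (le_of_not_ge hyz)]
  have h₁ : 0 ≤ (x - y) ^ 2 * (x + y - z) := mul_nonneg (sq_nonneg _) (by linarith)
  have h₂ : 0 ≤ z * ((x - z) * (y - z)) :=
    mul_nonneg hz (mul_nonneg (by linarith) (by linarith))
  linarith

theorem cubic_newton_schur {f : ℝ[X]} (hf : f.Splits) (hdeg : f.natDegree = 3)
    (hpos : ∀ k ≤ 3, 0 < f.coeff k) :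
    3 * f.coeff 2 * f.coeff 0 ≤ f.coeff 1 ^ 2 ∧
    4 * f.coeff 2 * f.coeff 1 * f.coeff 0 ≤
      f.coeff 1 ^ 3 + 9 * f.coeff 3 * f.coeff 0 ^ 2 := by
  have hneg : ∀ r ∈ f.roots, r < 0 := by
    intro r hr
    by_contra! h
    have hroot : f.eval r = 0 := isRoot_of_mem_roots hr
    rw [eval_eq_sum_range, hdeg] at hroot
    have h0 : 0 < ∑ i ∈ Finset.range (3 + 1), f.coeff i * r ^ i := by
      rw [Finset.sum_range_succ']
      have := hpos 0 (by norm_num)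
      have : 0 ≤ ∑ i ∈ Finset.range 3, f.coeff (i + 1) * r ^ (i + 1) :=
        Finset.sum_nonneg fun i hi => mul_nonneg
          (hpos _ (by simpa using hi)).le (pow_nonneg h _)
      simp only [pow_zero, mul_one]
      linarith
    linarith
  have hcard : f.roots.card = 3 := (splits_iff_card_roots.mp hf).trans hdeg
  obtain ⟨x, y, z, hr⟩ := Multiset.card_eq_three.mp hcard
  have hx : x < 0 := hneg x (by simp [hr])
  have hy : y < 0 := hneg y (by simp [hr])
  have hz : z < 0 := hneg z (by simp [hr])
  have hlead : 0 < f.leadingCoeff := by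
    rw [leadingCoeff, hdeg]; exact hpos 3 le_rfl
  have hf' := hf.eq_prod_roots
  generalize f.leadingCoeff = a at hlead hf'
  have hcubic : f = Cubic.toPoly
      ⟨a, -a * (x + y + z), a * (x * y + y * z + z * x), -a * (x * y * z)⟩ := by
    rw [hf', hr, Cubic.toPoly]
    simp only [Multiset.insert_eq_cons, Multiset.map_cons, Multiset.map_singleton,
      Multiset.prod_cons, Multiset.prod_singleton, map_mul, map_add, map_neg]
    ring
  rw [hcubic, Cubic.coeff_eq_a, Cubic.coeff_eq_b, Cubic.coeff_eq_c, Cubic.coeff_eq_d]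
  constructor
  · have : 0 ≤ a ^ 2 * ((x * y - y * z) ^ 2 + (y * z - z * x) ^ 2 + (z * x - x * y) ^ 2) := by
      positivity
    linarith
  · have := mul_nonneg (pow_pos hlead 3).le (schur_inequality (mul_pos_of_neg_of_neg hx hy).le
      (mul_pos_of_neg_of_neg hy hz).le (mul_pos_of_neg_of_neg hz hx).le)
    linarith

theorem lower_quadratic_contradiction {E₀ E₁ E₂ E₃ E₄ E₅ t : ℝ} (h₂ : 0 < E₂) (h₃ : 0 < E₃)
    (ht : 0 < t)
    (newton₁ : E₁ * E₃ ≤ E₂ ^ 2) (newton₂ : E₂ * E₄ ≤ E₃ ^ 2)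
    (schur₁ : 4 * E₁ * E₂ * E₃ ≤ 3 * E₂ ^ 3 + E₀ * E₃ ^ 2)
    (schur₂ : 4 * E₂ * E₃ * E₄ ≤ 3 * E₃ ^ 3 + E₅ * E₂ ^ 2)
    (hF : t ^ 2 * E₀ - 16 * t * E₁ + 28 * E₂ < 0)
    (hG : 2 * t ^ 2 * E₃ - 5 * t * E₄ + 2 * E₅ < 0) : False := by
  rcases lt_or_ge (2 * E₃) (t * E₂) with h | h
  · have hG' : E₂ ^ 2 * (2 * t ^ 2 * E₃ - 5 * t * E₄ + 2 * E₅) < 0 :=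
      mul_neg_of_pos_of_neg (by positivity) hG
    have h₄ : 0 ≤ (E₃ ^ 2 - E₂ * E₄) * (5 * t * E₂ - 8 * E₃) :=
      mul_nonneg (by linarith) (by linarith)
    have h₅ : 0 < E₃ * ((2 * (t * E₂) - E₃) * (t * E₂ - 2 * E₃)) :=
      mul_pos h₃ (mul_pos (by linarith) (by linarith))
    linarith
  · have hF' : E₃ ^ 2 * (t ^ 2 * E₀ - 16 * t * E₁ + 28 * E₂) < 0 :=
      mul_neg_of_pos_of_neg (by positivity) hF
    have h₄ : 0 ≤ (E₂ ^ 2 - E₁ * E₃) * (4 * t * (4 * E₃ - t * E₂)) :=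
      mul_nonneg (by linarith) (mul_nonneg (by linarith) (by linarith))
    have h₅ : 0 ≤ E₂ * ((2 * E₃ - t * E₂) * (14 * E₃ - t * E₂)) :=
      mul_nonneg h₂.le (mul_nonneg (by linarith) (by linarith))
    have h₆ := mul_le_mul_of_nonneg_left schur₁ (sq_nonneg t)
    linarith

theorem degree_eight_newton_schur {A : ℝ[X]} (hA : A.Splits) (hdeg : A.natDegree = 8)
    (hpos : ∀ k ≤ 8, 0 < A.coeff k) :
    (A.coeff 7 / 8 * (A.coeff 5 / 56) ≤ (A.coeff 6 / 28) ^ 2 ∧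
      4 * (A.coeff 7 / 8) * (A.coeff 6 / 28) * (A.coeff 5 / 56) ≤
        3 * (A.coeff 6 / 28) ^ 3 + A.coeff 8 * (A.coeff 5 / 56) ^ 2) ∧
    (A.coeff 6 / 28 * (A.coeff 4 / 70) ≤ (A.coeff 5 / 56) ^ 2 ∧
      4 * (A.coeff 6 / 28) * (A.coeff 5 / 56) * (A.coeff 4 / 70) ≤
        3 * (A.coeff 5 / 56) ^ 3 + A.coeff 3 / 56 * (A.coeff 6 / 28) ^ 2) := by
  have natDegree_eq_three : ∀ g : ℝ[X], g.natDegree ≤ 3 → 0 < g.coeff 3 → g.natDegree = 3 :=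
    fun g h₁ h₂ => le_antisymm h₁ (le_natDegree_of_ne_zero h₂.ne')
  constructor
  · have hc : ∀ k, (derivative^[5] A).coeff k = (k + 5).descFactorial 5 * A.coeff (k + 5) :=
      fun k => by rw [coeff_iterate_derivative, nsmul_eq_mul]
    have hp : ∀ k ≤ 3, 0 < (derivative^[5] A).coeff k := fun k hk => by
      rw [hc]
      exact mul_pos (Nat.cast_pos.mpr (Nat.descFactorial_pos.mpr (by omega)))
        (hpos _ (by omega))
    have hd : (derivative^[5] A).natDegree ≤ 3 :=
      (natDegree_iterate_derivative A 5).trans (by omega)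
    obtain ⟨h₁, h₂⟩ := cubic_newton_schur (hA.iterate_derivative 5)
      (natDegree_eq_three _ hd (hp 3 le_rfl)) hp
    simp only [hc] at h₁ h₂
    norm_num [Nat.descFactorial] at h₁ h₂
    constructor <;> linarith
  · have hd3 : (derivative^[3] A).natDegree = 5 := by
      refine le_antisymm ((natDegree_iterate_derivative A 3).trans (by omega))
        (le_natDegree_of_ne_zero ?_)
      rw [coeff_iterate_derivative, nsmul_eq_mul]
      exact (mul_pos (Nat.cast_pos.mpr (Nat.descFactorial_pos.mpr (by omega)))
        (hpos _ (by omega))).ne'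
    have hc : ∀ k ≤ 3, (derivative^[2] (derivative^[3] A).reverse).coeff k =
        (k + 2).descFactorial 2 * ((6 - k).descFactorial 3 * A.coeff (6 - k)) := fun k hk => by
      rw [coeff_iterate_derivative, nsmul_eq_mul, coeff_reverse, hd3,
        revAt_le (by omega), coeff_iterate_derivative, nsmul_eq_mul,
        show 5 - (k + 2) + 3 = 6 - k by omega]
    have hp : ∀ k ≤ 3, 0 < (derivative^[2] (derivative^[3] A).reverse).coeff k :=
      fun k hk => by
        rw [hc k hk]
        exact mul_pos (Nat.cast_pos.mpr (Nat.descFactorial_pos.mpr (by omega)))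
          (mul_pos (Nat.cast_pos.mpr (Nat.descFactorial_pos.mpr (by omega)))
            (hpos _ (by omega)))
    have hd : (derivative^[2] (derivative^[3] A).reverse).natDegree ≤ 3 :=
      (natDegree_iterate_derivative _ 2).trans
        (Nat.sub_le_sub_right ((reverse_natDegree_le _).trans hd3.le) 2)
    obtain ⟨h₁, h₂⟩ := cubic_newton_schur ((hA.iterate_derivative 3).reverse.iterate_derivative 2)
      (natDegree_eq_three _ hd (hp 3 le_rfl)) hp
    rw [hc 0 (by norm_num), hc 1 (by norm_num), hc 2 (by norm_num)] at h₁ h₂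
    rw [hc 3 (by norm_num)] at h₂
    norm_num [Nat.descFactorial] at h₁ h₂
    constructor <;> linarith

theorem Polynomial.Monic.four_mul_coeff_zero_gt_of_roots_eq_zero {q : ℝ[X]} (hq : q.Monic)
    (hdeg : q.natDegree = 2) (hroots : q.roots = 0) : q.coeff 1 ^ 2 < 4 * q.coeff 0 := by
  by_contra! h
  have hroot : q.IsRoot ((-q.coeff 1 + √(q.coeff 1 ^ 2 - 4 * q.coeff 0)) / 2) := by
    have h2 : q.coeff 2 = 1 := hdeg ▸ hq.coeff_natDegree
    rw [IsRoot, eval_eq_sum_range, hdeg]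
    simp only [Finset.sum_range_succ, Finset.sum_range_zero, h2]
    linear_combination
      (1 / 4) * Real.sq_sqrt (show 0 ≤ q.coeff 1 ^ 2 - 4 * q.coeff 0 by linarith)
  have := (mem_roots hq.ne_zero).mpr hroot
  simp [hroots] at this

/-- For `d = 10`, the sign pattern `Σ_{2,4,5}` is not realizable with the pair
`(0, 8)`. -/
theorem stmt10 :
    ¬ ∃ P : Polynomial ℝ, P.Monic ∧ P.natDegree = 10 ∧
      0 < P.coeff 10 ∧ 0 < P.coeff 9 ∧
      P.coeff 8 < 0 ∧ P.coeff 7 < 0 ∧ P.coeff 6 < 0 ∧ P.coeff 5 < 0 ∧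
      0 < P.coeff 4 ∧ 0 < P.coeff 3 ∧ 0 < P.coeff 2 ∧ 0 < P.coeff 1 ∧
      0 < P.coeff 0 ∧
      realizesPair P 0 8 := by
  rintro ⟨P, hmonic, hdeg, -, -, hP8, -, -, hP5, -, -, -, -, -, -, hpos, hneg, h0⟩
  have hroots : ∀ r ∈ P.roots, r < 0 := fun r hr =>
    (lt_or_gt_of_ne (ne_of_mem_of_not_mem hr h0)).resolve_right
      (Multiset.filter_eq_nil.mp (Multiset.card_eq_zero.mp hpos) r hr)
  have hcard : P.roots.card = 8 := by rwa [Multiset.filter_eq_self.mpr hroots] at hneg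
  obtain ⟨q, hPq, hqdeg, hqroots⟩ := exists_prod_multiset_X_sub_C_mul P
  have hAmonic : (P.roots.map fun r => X - C r).prod.Monic :=
    monic_multiset_prod_of_monic _ _ fun r _ => monic_X_sub_C r
  have hAdeg : (P.roots.map fun r => X - C r).prod.natDegree = 8 :=
    (natDegree_multiset_prod_X_sub_C_eq_card _).trans hcard
  have hAsplits : (P.roots.map fun r => X - C r).prod.Splits :=
    .multisetProd fun g hg => by
      obtain ⟨r, -, rfl⟩ := Multiset.mem_map.mp hg
      exact .X_sub_C r
  have hApos := coeff_pos_of_prod_X_sub_C_neg P.roots hroots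
  rw [hcard] at hApos
  generalize (P.roots.map fun r => X - C r).prod = A at *
  have hqmonic : q.Monic := hAmonic.of_mul_monic_left (hPq ▸ hmonic)
  have hq2 : q.natDegree = 2 := by omega
  have hdisc := hqmonic.four_mul_coeff_zero_gt_of_roots_eq_zero hq2 hqroots
  have hP : P = A * X * X + C (q.coeff 1) * (A * X) + C (q.coeff 0) * A := by
    have h2 : q.coeff 2 = 1 := hq2 ▸ hqmonic.coeff_natDegree
    rw [← hPq]
    nth_rw 1 [q.as_sum_range, hq2]
    simp only [Finset.sum_range_succ, Finset.sum_range_zero, ← C_mul_X_pow_eq_monomial, h2,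
      map_one]
    ring
  rw [hP] at hP8 hP5
  simp only [coeff_add, coeff_mul_X, coeff_C_mul] at hP8 hP5
  generalize q.coeff 1 = u at *
  generalize q.coeff 0 = v at *
  have hA3 := hApos 3 (by norm_num)
  have hA5 := hApos 5 (by norm_num)
  have hA6 := hApos 6 (by norm_num)
  have hA7 := hApos 7 (by norm_num)
  have hA8 := hApos 8 (by norm_num)
  have hu : u < 0 := by
    by_contra! h
    have h₁ := mul_nonneg h hA7.le
    have h₂ : 0 < v * A.coeff 8 := mul_pos (by linarith [sq_nonneg u]) hA8
    linarith
  obtain ⟨⟨newton₁, schur₁⟩, newton₂, schur₂⟩ :=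
    degree_eight_newton_schur hAsplits hAdeg hApos
  refine lower_quadratic_contradiction (t := -u / 2) (by positivity) (by positivity)
    (by linarith) newton₁ newton₂ schur₁ schur₂ ?_ ?_
  · linarith [mul_pos (sub_pos.mpr hdisc) hA8]
  · linarith [mul_pos (sub_pos.mpr hdisc) hA5]
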